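/- Let k, d, λ ≥ 1 be integers with d ≥ λ, k > λ and α(d,λ) ≥ 1 (the trivial range). Then m*(k,d,λ) < m(k,d,λ), where m(k,d,λ) satisfies m(k,d,λ) ≥ d−λ+k+⌈k/λ⌉−1; in particular m*(k,d,λ) = d−λ+k < d−λ+k+⌈k/λ⌉−1. -/

import Mathlib

open Finset

noncomputable section

/-- Points of `ℝ^d`. -/
abbrev Pt (d : ℕ) : Type := Fin d → ℝ

/-- `L` is a complete Kneser `(d-λ)`-transversal of the finite point set `X` with respect
to `k`. -/
def IsCompleteKneserTransversal (k d lam : ℕ) (X : Finset (Pt d))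
    (L : AffineSubspace ℝ (Pt d)) : Prop :=
  Module.finrank ℝ L.direction = d - lam ∧
  (∃ T : Finset (Pt d), T ⊆ X ∧ T.card = d - lam + 1 ∧ (T : Set (Pt d)) ⊆ (L : Set (Pt d))) ∧
  ∀ Y : Finset (Pt d), Y ⊆ X → Y.card = k →
    ((convexHull ℝ (Y : Set (Pt d))) ∩ (L : Set (Pt d))).Nonempty

/-- `X` has a complete Kneser `(d-λ)`-transversal with respect to `k`. -/
def HasCKT (k d lam : ℕ) (X : Finset (Pt d)) : Prop :=
  ∃ L : AffineSubspace ℝ (Pt d), IsCompleteKneserTransversal k d lam X L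

/-- The set of positive integers `n` such that every set of `n` points in `ℝ^d` has a
complete Kneser `(d-λ)`-transversal with respect to `k`; `m*(k,d,λ)` is its maximum. -/
def mStarSet (k d lam : ℕ) : Set ℕ :=
  {n | 0 < n ∧ ∀ X : Finset (Pt d), X.card = n → HasCKT k d lam X}

/-- `α(d,λ) = (λ-1)/⌈d/2⌉` (note `⌈d/2⌉ = (d+1)/2` as naturals). -/
def alphaVal (d lam : ℕ) : ℝ := ((lam : ℝ) - 1) / (((d + 1) / 2 : ℕ) : ℝ)

/-- `X` has a (not necessarily complete) Kneser `(d-λ)`-transversal with respect to `k`: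
a nonempty affine subspace of dimension `d-λ` meeting the convex hull of every
`k`-element subset of `X`. -/
def HasKT (k d lam : ℕ) (X : Finset (Pt d)) : Prop :=
  ∃ L : AffineSubspace ℝ (Pt d), Module.finrank ℝ L.direction = d - lam ∧
    (L : Set (Pt d)).Nonempty ∧
    ∀ Y : Finset (Pt d), Y ⊆ X → Y.card = k →
      ((convexHull ℝ (Y : Set (Pt d))) ∩ (L : Set (Pt d))).Nonempty

/-- The set of positive integers `n` such that every set of `n` points in `ℝ^d` admits
some `(d-λ)`-dimensional affine subspace transversal to the convex hulls of all its
`k`-element subsets; `m(k,d,λ)` is its maximum. -/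
def mSet (k d lam : ℕ) : Set ℕ :=
  {n | 0 < n ∧ ∀ X : Finset (Pt d), X.card = n → HasKT k d lam X}

theorem Submodule.exists_le_finrank_eq {K V : Type*} [Field K] [AddCommGroup V] [Module K V]
    [FiniteDimensional K V] (W : Submodule K V) {n : ℕ} (hW : Module.finrank K W ≤ n)
    (hn : n ≤ Module.finrank K V) :
    ∃ W' : Submodule K V, W ≤ W' ∧ Module.finrank K W' = n := by
  induction n, hW using Nat.le_induction with
  | base => exact ⟨W, le_rfl, rfl⟩
  | succ m _ ih =>
    obtain ⟨U, hWU, hU⟩ := ih (by omega)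
    obtain ⟨v, hv⟩ : ∃ v, v ∉ U := by
      by_contra! h
      have htop : U = ⊤ := Submodule.eq_top_iff'.2 h
      rw [htop, finrank_top] at hU
      omega
    refine ⟨Submodule.span K {v} ⊔ U, hWU.trans le_sup_right, ?_⟩
    have hlt := Submodule.finrank_lt_finrank_of_lt (Submodule.covBy_span_singleton_sup hv).lt
    have hle := Submodule.finrank_add_le_finrank_add_finrank (Submodule.span K {v}) U
    have hv1 : Module.finrank K (Submodule.span K {v}) ≤ 1 := by
      simpa using finrank_span_le_card (R := K) ({v} : Set V)
    omega

/-- A family of points is affinely independent if each point is separated from all the others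
by an affine functional vanishing on them. -/
theorem affineIndependent_of_exists_affineMap {K V ι : Type*} [Field K] [AddCommGroup V]
    [Module K V] {p : ι → V}
    (h : ∀ i, ∃ f : V →ᵃ[K] K, f (p i) ≠ 0 ∧ ∀ j, j ≠ i → f (p j) = 0) :
    AffineIndependent K p := by
  rw [affineIndependent_iff]
  intro s w hw hs i hi
  obtain ⟨f, hfi, hfj⟩ := h i
  have hsum : ∑ j ∈ s, w j * f (p j) = 0 := by
    have hlin : ∑ j ∈ s, w j * f.linear (p j) = 0 := by
      simpa using congrArg f.linear hs
    calc ∑ j ∈ s, w j * f (p j) = ∑ j ∈ s, (w j * f.linear (p j) + w j * f 0) := by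
          refine Finset.sum_congr rfl fun j _ => ?_
          rw [f.decomp]
          simp [mul_add]
      _ = 0 := by rw [Finset.sum_add_distrib, hlin, ← Finset.sum_mul, hw]; simp
  rw [Finset.sum_eq_single_of_mem i hi fun j _ hj => by rw [hfj j hj, mul_zero]] at hsum
  exact (mul_eq_zero.1 hsum).resolve_right hfi

/-- The moment curve `t ↦ (t, t², …, t^d)`. -/
def momentCurve (d : ℕ) (t : ℝ) : Pt d := fun i => t ^ ((i : ℕ) + 1)

/-- The affine functional on `ℝ^d` restricting to the polynomial `p` along the moment curve. -/
def polyFunctional (d : ℕ) (p : Polynomial ℝ) : Pt d →ᵃ[ℝ] ℝ :=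
  (∑ i : Fin d, p.coeff ((i : ℕ) + 1) • LinearMap.proj (R := ℝ) (φ := fun _ => ℝ) i).toAffineMap +
    AffineMap.const ℝ (Pt d) (p.coeff 0)

theorem polyFunctional_momentCurve {d : ℕ} {p : Polynomial ℝ} (hp : p.natDegree ≤ d) (t : ℝ) :
    polyFunctional d p (momentCurve d t) = p.eval t := by
  rw [Polynomial.eval_eq_sum_range' (Nat.lt_succ_of_le hp), Finset.sum_range_succ',
    Finset.sum_range]
  simp [polyFunctional, momentCurve]

theorem momentCurve_injective {d : ℕ} (hd : 1 ≤ d) : Function.Injective (momentCurve d) := by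
  intro s t h
  simpa [momentCurve] using congrFun h ⟨0, hd⟩

theorem affineIndependent_momentCurve {d : ℕ} {S : Finset ℝ} (hS : S.card ≤ d + 1) :
    AffineIndependent ℝ fun t : S => momentCurve d t := by
  classical
  refine affineIndependent_of_exists_affineMap fun s => ?_
  let p : Polynomial ℝ := ∏ t ∈ S.erase s, (Polynomial.X - Polynomial.C t)
  have hp : p.natDegree ≤ d := by
    rw [Polynomial.natDegree_finsetProd_X_sub_C_eq_card, Finset.card_erase_of_mem s.2]
    omega
  refine ⟨polyFunctional d p, ?_, fun t hts => ?_⟩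
  · rw [polyFunctional_momentCurve hp, Polynomial.eval_prod]
    refine Finset.prod_ne_zero_iff.2 fun t ht => ?_
    simpa [sub_eq_zero] using (Finset.ne_of_mem_erase ht).symm
  · rw [polyFunctional_momentCurve hp, Polynomial.eval_prod]
    refine Finset.prod_eq_zero (Finset.mem_erase.2 ⟨fun h => hts (Subtype.ext h), t.2⟩) ?_
    simp

/-- Neighborliness of the moment curve: at most `d/2` of its points are cut out by a
supporting hyperplane. -/
theorem exists_affineMap_supporting_momentCurve {d : ℕ} {S : Finset ℝ} (hS : 2 * S.card ≤ d) :
    ∃ f : Pt d →ᵃ[ℝ] ℝ, (∀ t ∈ S, f (momentCurve d t) = 0) ∧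
      ∀ t, t ∉ S → 0 < f (momentCurve d t) := by
  let p : Polynomial ℝ := (∏ s ∈ S, (Polynomial.X - Polynomial.C s)) ^ 2
  have hp : p.natDegree ≤ d := by
    rw [Polynomial.natDegree_pow, Polynomial.natDegree_finsetProd_X_sub_C_eq_card]
    exact hS
  refine ⟨polyFunctional d p, fun t ht => ?_, fun t ht => ?_⟩
  · rw [polyFunctional_momentCurve hp, Polynomial.eval_pow, Polynomial.eval_prod,
      Finset.prod_eq_zero ht (by simp)]
    simp
  · rw [polyFunctional_momentCurve hp, Polynomial.eval_pow, Polynomial.eval_prod]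
    refine sq_pos_of_ne_zero (Finset.prod_ne_zero_iff.2 fun s hs => ?_)
    simpa [sub_eq_zero] using fun h : t = s => ht (h ▸ hs)

theorem hasCKT_of_card_eq {k d lam : ℕ} (hk : 1 ≤ k) {X : Finset (Pt d)}
    (hX : X.card = d - lam + k) : HasCKT k d lam X := by
  classical
  obtain ⟨T, hTX, hT⟩ := Finset.exists_subset_card_eq (s := X) (n := d - lam + 1) (by omega)
  obtain ⟨x, hx⟩ : T.Nonempty := Finset.card_pos.1 (by omega)
  have hspan : Module.finrank ℝ (vectorSpan ℝ (T : Set (Pt d))) ≤ d - lam := by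
    have h := finrank_vectorSpan_image_finset_le ℝ id T hT
    rwa [Finset.coe_image, Set.image_id] at h
  obtain ⟨W, hTW, hW⟩ := Submodule.exists_le_finrank_eq _ hspan (by simp)
  have hTL : (T : Set (Pt d)) ⊆ AffineSubspace.mk' x W := fun y hy =>
    AffineSubspace.mem_mk'.2 (hTW (vsub_mem_vectorSpan ℝ hy (Finset.mem_coe.2 hx)))
  refine ⟨AffineSubspace.mk' x W, by rwa [AffineSubspace.direction_mk'], ⟨T, hTX, hT, hTL⟩,
    fun Y hYX hY => ?_⟩
  have hYT : ¬ Disjoint Y T := fun hdisj => by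
    have h := Finset.card_le_card (Finset.union_subset hYX hTX)
    rw [Finset.card_union_of_disjoint hdisj] at h
    omega
  obtain ⟨y, hyY, hyT⟩ := Finset.not_disjoint_iff.1 hYT
  exact ⟨y, subset_convexHull ℝ _ hyY, hTL hyT⟩

/-- Points on the moment curve have no complete Kneser transversal of small dimension. -/
theorem not_hasCKT_image_momentCurve {k d lam : ℕ} (hd : 2 * (d - lam + 1) ≤ d) {S : Finset ℝ}
    (hS : d - lam + k < S.card) : ¬ HasCKT k d lam (S.image (momentCurve d)) := by
  classical
  rintro ⟨L, hL, ⟨T, hTS, hT, hTL⟩, hY⟩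
  have hinj : Function.Injective (momentCurve d) := momentCurve_injective (by omega)
  obtain ⟨R, hRS, rfl⟩ := Finset.subset_image_iff.1 hTS
  rw [Finset.card_image_of_injective _ hinj] at hT
  obtain ⟨f, hf0, hfpos⟩ := exists_affineMap_supporting_momentCurve (d := d) (S := R) (by omega)
  have hspan : affineSpan ℝ (Set.range fun t : R => momentCurve d t) = L := by
    refine (affineIndependent_momentCurve (by omega)).affineSpan_eq_of_le_of_card_eq_finrank_add_one
      (affineSpan_le.2 ?_) (by simp [hL, hT])
    rintro _ ⟨t, rfl⟩
    exact hTL (Finset.mem_coe.2 (Finset.mem_image_of_mem _ t.2))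
  have hfL : ∀ x ∈ L, f x = 0 := by
    intro x hx
    rw [← hspan] at hx
    refine affineSpan_induction hx ?_ fun c u v w hu hv hw => ?_
    · rintro _ ⟨t, rfl⟩
      exact hf0 t t.2
    · rw [AffineMap.map_vadd, map_smul, f.linearMap_vsub, hu, hv, hw]
      simp
  obtain ⟨Q, hQ, hQk⟩ := Finset.exists_subset_card_eq (s := S \ R) (n := k) (by
    rw [Finset.card_sdiff_of_subset hRS]
    omega)
  obtain ⟨x, hxQ, hxL⟩ := hY (Q.image (momentCurve d))
    (Finset.image_subset_image (hQ.trans Finset.sdiff_subset))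
    (by rw [Finset.card_image_of_injective _ hinj, hQk])
  have hpos : x ∈ f ⁻¹' Set.Ioi 0 := by
    refine convexHull_min ?_ ((convex_Ioi (0 : ℝ)).affine_preimage f) hxQ
    intro y hy
    obtain ⟨t, ht, rfl⟩ := Finset.mem_image.1 (Finset.mem_coe.1 hy)
    exact hfpos t (Finset.mem_sdiff.1 (hQ ht)).2
  exact (ne_of_gt hpos) (hfL x hxL)

theorem isGreatest_mStarSet {k d lam : ℕ} (hk : 1 ≤ k) (hd : 2 * (d - lam + 1) ≤ d) :
    IsGreatest (mStarSet k d lam) (d - lam + k) := by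
  classical
  refine ⟨⟨by omega, fun X hX => hasCKT_of_card_eq hk hX⟩, fun n hn => ?_⟩
  by_contra! hlt
  let S : Finset ℝ := (Finset.range n).image Nat.cast
  have hS : S.card = n := by
    rw [Finset.card_image_of_injective _ Nat.cast_injective, Finset.card_range]
  refine not_hasCKT_image_momentCurve hd (hlt.trans_eq hS.symm) (hn.2 _ ?_)
  rw [Finset.card_image_of_injective _ (momentCurve_injective (by omega)), hS]

theorem two_mul_sub_add_one_le_of_one_le_alphaVal {d lam : ℕ} (hd : 1 ≤ d) (hlam : lam ≤ d)
    (hα : 1 ≤ alphaVal d lam) : 2 * (d - lam + 1) ≤ d := by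
  have hpos : (0 : ℝ) < (((d + 1) / 2 : ℕ) : ℝ) := by
    exact_mod_cast (by omega : 0 < (d + 1) / 2)
  rw [alphaVal, one_le_div hpos, le_sub_iff_add_le] at hα
  have hle : (d + 1) / 2 + 1 ≤ lam := by exact_mod_cast hα
  omega


/-- in the trivial range `α(d,λ) ≥ 1` with `k > λ`, assuming the cited
lower bound `m(k,d,λ) ≥ d-λ+k+⌈k/λ⌉-1` (i.e. `d-λ+k+⌈k/λ⌉-1 ∈ mSet`, where
`⌈k/λ⌉ = (k+λ-1)/λ`), we have `m*(k,d,λ) = d-λ+k` and `m*(k,d,λ) < m(k,d,λ)`: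
every member of `mStarSet` is strictly smaller than some member of `mSet`. -/
theorem mStar_lt_m (k d lam : ℕ) (hd : 1 ≤ d) (hlam : 1 ≤ lam) (hdl : lam ≤ d)
    (hk : lam < k) (hα : 1 ≤ alphaVal d lam)
    (hm : d - lam + k + (k + lam - 1) / lam - 1 ∈ mSet k d lam) :
    IsGreatest (mStarSet k d lam) (d - lam + k) ∧
    d - lam + k < d - lam + k + (k + lam - 1) / lam - 1 ∧
    ∀ n ∈ mStarSet k d lam, ∃ n' ∈ mSet k d lam, n < n' := by
  have hgreatest := isGreatest_mStarSet (k := k) (by omega)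
    (two_mul_sub_add_one_le_of_one_le_alphaVal hd hdl hα)
  have hceil : 2 ≤ (k + lam - 1) / lam := (Nat.le_div_iff_mul_le hlam).2 (by omega)
  have hlt : d - lam + k < d - lam + k + (k + lam - 1) / lam - 1 := by omega
  exact ⟨hgreatest, hlt, fun n hn => ⟨_, hm, (hgreatest.2 hn).trans_lt hlt⟩⟩
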